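/- arXiv:2311.16401 — 7 statements merged into one kernel-verified Lean document; each statement's English description precedes it below -/
import Mathlib

section
/- Let a ∈ Σ^N and let 1 ≤ u < v ≤ N be indices such that the prefix a[1:v] is distinct and the suffix a[u:N] is distinct. Let b = a[1:u−1] ++ a[v+1:N]. Then LDS(a) = (v − u + 1) + LDS(b). -/
/-- The substring `a[i:j]` (1-indexed, positions `i..j`) is *distinct*:
its characters are pairwise different. -/
def DistinctOn {α : Type*} (a : ℕ → α) (i j : ℕ) : Prop :=
  ∀ u ∈ Finset.Icc i j, ∀ v ∈ Finset.Icc i j, a u = a v → u = v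

open Classical in
/-- `LDS a N`: the length of a longest distinct substring of the string
`a_1 … a_N` (equal to `0` for the empty string). -/
noncomputable def LDS {α : Type*} (a : ℕ → α) (N : ℕ) : ℕ :=
  ((Finset.Icc 1 N ×ˢ Finset.Icc 1 N).filter
      (fun p => p.1 ≤ p.2 ∧ DistinctOn a p.1 p.2)).sup fun p => p.2 - p.1 + 1

/-- A distinct interval, possibly empty, has length at most `LDS`. -/
lemma DistinctOn.length_le_LDS {α : Type*} {a : ℕ → α} {N i j : ℕ} (hi : 1 ≤ i) (hj : j ≤ N)
    (h : DistinctOn a i j) : j + 1 - i ≤ LDS a N := by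
  classical
  by_cases hij : i ≤ j
  · have hmem : (i, j) ∈ (Finset.Icc 1 N ×ˢ Finset.Icc 1 N).filter
        (fun p => p.1 ≤ p.2 ∧ DistinctOn a p.1 p.2) := by
      simp only [Finset.mem_filter, Finset.mem_product, Finset.mem_Icc]
      exact ⟨by omega, hij, h⟩
    have hle : j - i + 1 ≤ LDS a N := by
      unfold LDS
      convert Finset.le_sup (f := fun p : ℕ × ℕ => p.2 - p.1 + 1) hmem
    omega
  · omega

lemma LDS_le {α : Type*} {a : ℕ → α} {N K : ℕ}
    (h : ∀ i j, 1 ≤ i → i ≤ j → j ≤ N → DistinctOn a i j → j + 1 - i ≤ K) : LDS a N ≤ K := by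
  refine Finset.sup_le fun p hp => ?_
  simp only [Finset.mem_filter, Finset.mem_product, Finset.mem_Icc] at hp
  have := h p.1 p.2 hp.1.1.1 hp.2.1 hp.1.2.2 hp.2.2
  omega

lemma DistinctOn.mono {α : Type*} {a : ℕ → α} {i j i' j' : ℕ} (h : DistinctOn a i j)
    (hi : i ≤ i') (hj : j' ≤ j) : DistinctOn a i' j' :=
  fun x hx y hy => h x (Finset.Icc_subset_Icc hi hj hx) y (Finset.Icc_subset_Icc hi hj hy)

/-- Deleting `m` characters at position `u` from a distinct interval keeps it distinct. -/
lemma DistinctOn.delete {α : Type*} {a : ℕ → α} {i j u m : ℕ} (h : DistinctOn a i (j + m)) :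
    DistinctOn (fun p => if p < u then a p else a (p + m)) i j := by
  intro x hx y hy hxy
  simp only [Finset.mem_Icc] at hx hy
  have key := fun s t (hs : i ≤ s ∧ s ≤ j + m) (ht : i ≤ t ∧ t ≤ j + m) =>
    h s (Finset.mem_Icc.2 hs) t (Finset.mem_Icc.2 ht)
  dsimp only at hxy
  split_ifs at hxy
  all_goals
    have := key _ _ (by omega) (by omega) hxy
    omega

/-- Reinserting the deleted overlap of a distinct prefix and a distinct suffix
keeps a distinct interval straddling the cut distinct. -/
lemma DistinctOn.of_delete {α : Type*} {a : ℕ → α} {N i j u m : ℕ}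
    (hpre : DistinctOn a 1 (u + m - 1)) (hsuf : DistinctOn a u N) (hi : 1 ≤ i)
    (hj : j + m ≤ N)
    (h : DistinctOn (fun p => if p < u then a p else a (p + m)) i j) :
    DistinctOn a i (j + m) := by
  have cross : ∀ x y, i ≤ x → x < u → u + m ≤ y → y ≤ j + m → a x ≠ a y := by
    intro x y hix hxu huy hyj hxy
    have := h x (Finset.mem_Icc.2 (by omega)) (y - m) (Finset.mem_Icc.2 (by omega)) (by
      dsimp only
      rw [if_pos hxu, if_neg (by omega), Nat.sub_add_cancel (by omega)]
      exact hxy)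
    omega
  intro x hx y hy hxy
  simp only [Finset.mem_Icc] at hx hy
  by_cases hsx : u ≤ x ∧ u ≤ y
  · exact hsuf x (Finset.mem_Icc.2 (by omega)) y (Finset.mem_Icc.2 (by omega)) hxy
  by_cases hpx : x < u + m ∧ y < u + m
  · exact hpre x (Finset.mem_Icc.2 (by omega)) y (Finset.mem_Icc.2 (by omega)) hxy
  rcases lt_or_ge x u with hxu | hux
  · exact absurd hxy (cross x y hx.1 hxu (by omega) hy.2)
  · exact absurd hxy.symm (cross y x hy.1 (by omega) (by omega) hx.2)

/-- If `a[1:v]` is distinct and `a[u:N]` is distinct, with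
`1 ≤ u < v ≤ N`, and `b = a[1:u-1] ++ a[v+1:N]`, then
`LDS(a) = (v - u + 1) + LDS(b)`. -/
theorem stmt0 {α : Type*} (a : ℕ → α) (N u v : ℕ)
    (hu : 1 ≤ u) (huv : u < v) (hvN : v ≤ N)
    (hpre : DistinctOn a 1 v) (hsuf : DistinctOn a u N) :
    LDS a N =
      (v - u + 1) +
        LDS (fun p => if p < u then a p else a (p + (v - u + 1))) (N - (v - u + 1)) := by
  obtain ⟨m, hm⟩ : ∃ m, m = v - u + 1 := ⟨_, rfl⟩
  rw [← hm]
  have hv : v = u + m - 1 := by omega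
  apply le_antisymm
  · -- the bound for a distinct interval containing the whole overlap
    have main : ∀ i j, 1 ≤ i → i ≤ u → v ≤ j → j ≤ N → DistinctOn a i j → j + 1 - i ≤
        m + LDS (fun p => if p < u then a p else a (p + m)) (N - m) := by
      intro i j hi hiu hvj hjN h
      have h' : DistinctOn a i (j - m + m) := h.mono le_rfl (by omega)
      have := (h'.delete (u := u)).length_le_LDS hi (show j - m ≤ N - m by omega)
      omega
    refine LDS_le fun i j hi hij hjN h => ?_
    by_cases hvj : v ≤ j
    · by_cases hiu : i ≤ u
      · exact main i j hi hiu hvj hjN h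
      · have := main u N hu le_rfl hvN le_rfl hsuf
        omega
    · have := main 1 v le_rfl hu le_rfl hvN hpre
      omega
  · have hlenp := hpre.length_le_LDS le_rfl hvN
    have hlens := hsuf.length_le_LDS hu le_rfl
    suffices LDS (fun p => if p < u then a p else a (p + m)) (N - m) ≤ LDS a N - m by omega
    refine LDS_le fun i j hi hij hjN h => ?_
    have := (DistinctOn.of_delete (hv ▸ hpre) hsuf hi (by omega) h).length_le_LDS hi
      (show j + m ≤ N by omega)
    omega
end

section
/- Assume that the string α[i2] ++ α[j1:j2] is distinct. Let j1 ≤ k1 ≤ k2 ≤ j2, let K = {k1,…,k2}, t = k2 − k1 + 1, and K⁺ = {prev(k1)} ∪ K. Define i1' = L(α, I, prev(k1)), i2' = min(i2, i1' + t − 1), and k2' = min(k2, R(α, I, succ(i2'))). Assume k1 ≤ k2' and let J = (i1', i2', k1, k2'). Then LDS(b, K⁺) = (i2 − i2') + (k1 − j1) + BLDS(α, J). -/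
/-- The positions `P(I)` of the string `b = α[i1:i2] ++ α[j1:j2]`. -/
def PosSet (i1 i2 j1 j2 : ℕ) : Finset ℕ := Finset.Icc i1 i2 ∪ Finset.Icc j1 j2

/-- The substring of `b` from position `p` to position `q` (i.e. on the positions
of `P(I)` between `p` and `q`) is distinct. -/
def DistinctBtw {α : Type*} (a : ℕ → α) (i1 i2 j1 j2 p q : ℕ) : Prop :=
  ∀ u ∈ PosSet i1 i2 j1 j2 ∩ Finset.Icc p q, ∀ v ∈ PosSet i1 i2 j1 j2 ∩ Finset.Icc p q,
    a u = a v → u = v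

/-- The length of the substring of `b` from position `p` to position `q`. -/
def LenBtw (i1 i2 j1 j2 p q : ℕ) : ℕ := (PosSet i1 i2 j1 j2 ∩ Finset.Icc p q).card

open Classical in
/-- `LDS(b, X)`: the maximum length of a distinct substring of `b` whose right
endpoint lies in `X` (`0` if there is none). -/
noncomputable def LDSX {α : Type*} (a : ℕ → α) (i1 i2 j1 j2 : ℕ) (X : Finset ℕ) : ℕ :=
  ((PosSet i1 i2 j1 j2 ×ˢ (X ∩ PosSet i1 i2 j1 j2)).filter
      (fun pq => pq.1 ≤ pq.2 ∧ DistinctBtw a i1 i2 j1 j2 pq.1 pq.2)).sup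
    fun pq => LenBtw i1 i2 j1 j2 pq.1 pq.2

open Classical in
/-- `BLDS(α, I)`: the maximum length of a distinct substring of `b` that contains
position `i2` or position `j1`. -/
noncomputable def BLDS {α : Type*} (a : ℕ → α) (i1 i2 j1 j2 : ℕ) : ℕ :=
  ((PosSet i1 i2 j1 j2 ×ˢ PosSet i1 i2 j1 j2).filter
      (fun pq => pq.1 ≤ pq.2 ∧
        ((pq.1 ≤ i2 ∧ i2 ≤ pq.2) ∨ (pq.1 ≤ j1 ∧ j1 ≤ pq.2)) ∧
        DistinctBtw a i1 i2 j1 j2 pq.1 pq.2)).sup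
    fun pq => LenBtw i1 i2 j1 j2 pq.1 pq.2

/-- `L(α, I, k)`: the smallest position `p ∈ P(I)` such that the substring of `b`
from `p` to `k` is distinct. -/
noncomputable def Lfun {α : Type*} (a : ℕ → α) (i1 i2 j1 j2 k : ℕ) : ℕ :=
  sInf {p : ℕ | p ∈ PosSet i1 i2 j1 j2 ∧ p ≤ k ∧ DistinctBtw a i1 i2 j1 j2 p k}

/-- `R(α, I, k)`: the largest position `q ∈ P(I)` such that the substring of `b`
from `k` to `q` is distinct. -/
noncomputable def Rfun {α : Type*} (a : ℕ → α) (i1 i2 j1 j2 k : ℕ) : ℕ :=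
  sSup {q : ℕ | q ∈ PosSet i1 i2 j1 j2 ∧ k ≤ q ∧ DistinctBtw a i1 i2 j1 j2 k q}

/-- `prev(k)` for `k ∈ {j1,…,j2}`. -/
def prevP (i2 j1 k : ℕ) : ℕ := if k = j1 then i2 else k - 1

/-- `succ(k)` for `k ∈ {i1,…,i2}`. -/
def succP (i2 j1 k : ℕ) : ℕ := if k = i2 then j1 else k + 1

theorem mem_PosSet {i1 i2 j1 j2 x : ℕ} :
    x ∈ PosSet i1 i2 j1 j2 ↔ (i1 ≤ x ∧ x ≤ i2) ∨ (j1 ≤ x ∧ x ≤ j2) := by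
  simp [PosSet]

theorem distinctBtw_iff {α : Type*} {a : ℕ → α} {i1 i2 j1 j2 p q : ℕ} :
    DistinctBtw a i1 i2 j1 j2 p q ↔
      ∀ u v, u ∈ PosSet i1 i2 j1 j2 → v ∈ PosSet i1 i2 j1 j2 →
        p ≤ u → u ≤ q → p ≤ v → v ≤ q → a u = a v → u = v := by
  simp only [DistinctBtw, Finset.mem_inter, Finset.mem_Icc]
  constructor
  · intro h u v hu hv h1 h2 h3 h4
    exact h u ⟨hu, h1, h2⟩ v ⟨hv, h3, h4⟩
  · rintro h u ⟨hu, h1, h2⟩ v ⟨hv, h3, h4⟩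
    exact h u v hu hv h1 h2 h3 h4

theorem DistinctBtw.mono {α : Type*} {a : ℕ → α} {i1 i2 j1 j2 p q p' q' : ℕ}
    (h : DistinctBtw a i1 i2 j1 j2 p q) (hp : p ≤ p') (hq : q' ≤ q) :
    DistinctBtw a i1 i2 j1 j2 p' q' := by
  rw [distinctBtw_iff] at h ⊢
  intro u v hu hv h1 h2 h3 h4
  exact h u v hu hv (hp.trans h1) (h2.trans hq) (hp.trans h3) (h4.trans hq)

/-- A distinct substring stays distinct on fewer positions. -/
theorem DistinctBtw.of_subset {α : Type*} {a : ℕ → α} {i1 i2 j1 j2 i1' i2' j1' j2' p q : ℕ}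
    (h : DistinctBtw a i1 i2 j1 j2 p q)
    (hsub : PosSet i1' i2' j1' j2' ⊆ PosSet i1 i2 j1 j2) :
    DistinctBtw a i1' i2' j1' j2' p q := by
  rw [distinctBtw_iff] at h ⊢
  intro u v hu hv
  exact h u v (hsub hu) (hsub hv)

/-- A string is distinct once every two characters of it lie in a common distinct part, the parts
being its prefix up to `y`, its suffix from `x`, and what remains after removing the middle. -/
theorem DistinctBtw.glue {α : Type*} {a : ℕ → α} {i1 i2 j1 j2 i1' i2' j1' j2' p q x y : ℕ}
    (hpre : DistinctBtw a i1 i2 j1 j2 p y) (hsuf : DistinctBtw a i1 i2 j1 j2 x q)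
    (hout : DistinctBtw a i1' i2' j1' j2' p q)
    (hcov : ∀ u ∈ PosSet i1 i2 j1 j2, p ≤ u → u ≤ q → x ≤ u ∧ u ≤ y ∨
      u ∈ PosSet i1' i2' j1' j2' ∧ (x ≤ u ∨ u ≤ y)) :
    DistinctBtw a i1 i2 j1 j2 p q := by
  rw [distinctBtw_iff] at *
  intro u v hu hv h1 h2 h3 h4
  have hcu := hcov u hu h1 h2
  have hcv := hcov v hv h3 h4
  by_cases hy : u ≤ y ∧ v ≤ y
  · exact hpre u v hu hv h1 hy.1 h3 hy.2
  by_cases hx : x ≤ u ∧ x ≤ v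
  · exact hsuf u v hu hv hx.1 h2 hx.2 h4
  · exact hout u v (by grind) (by grind) h1 h2 h3 h4

theorem LenBtw_eq {i1 i2 j1 j2 : ℕ} (hij : i2 < j1) (p q : ℕ) :
    LenBtw i1 i2 j1 j2 p q =
      (min i2 q + 1 - max i1 p) + (min j2 q + 1 - max j1 p) := by
  have h : PosSet i1 i2 j1 j2 ∩ Finset.Icc p q =
      Finset.Icc (max i1 p) (min i2 q) ∪ Finset.Icc (max j1 p) (min j2 q) := by
    ext x
    simp only [mem_PosSet, Finset.mem_inter, Finset.mem_union, Finset.mem_Icc]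
    omega
  rw [LenBtw, h, Finset.card_union_of_disjoint, Nat.card_Icc, Nat.card_Icc]
  rw [Finset.disjoint_left]
  intro x
  simp only [Finset.mem_Icc]
  omega

/-- The length of a substring of `b`, according to the blocks in which its endpoints lie. -/
theorem LenBtw_cases {i1 i2 j1 j2 p q : ℕ} (hij : i2 < j1) (hp : p ∈ PosSet i1 i2 j1 j2)
    (hq : q ∈ PosSet i1 i2 j1 j2) (hpq : p ≤ q) :
    (q ≤ i2 ∧ LenBtw i1 i2 j1 j2 p q + p = q + 1) ∨
      (p ≤ i2 ∧ j1 ≤ q ∧ LenBtw i1 i2 j1 j2 p q + p + j1 = i2 + q + 2) ∨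
      (j1 ≤ p ∧ LenBtw i1 i2 j1 j2 p q + p = q + 1) := by
  rw [mem_PosSet] at hp hq
  rw [LenBtw_eq hij]
  rcases hp with hp | hp <;> rcases hq with hq | hq <;> omega

theorem le_LDSX {α : Type*} {a : ℕ → α} {i1 i2 j1 j2 p q : ℕ} {X : Finset ℕ}
    (hp : p ∈ PosSet i1 i2 j1 j2) (hq : q ∈ PosSet i1 i2 j1 j2) (hqX : q ∈ X) (hpq : p ≤ q)
    (hd : DistinctBtw a i1 i2 j1 j2 p q) :
    LenBtw i1 i2 j1 j2 p q ≤ LDSX a i1 i2 j1 j2 X := by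
  classical
  exact Finset.le_sup (f := fun pq : ℕ × ℕ => LenBtw i1 i2 j1 j2 pq.1 pq.2) (b := (p, q))
    (by simp [hp, hq, hqX, hpq, hd])

theorem LDSX_le {α : Type*} {a : ℕ → α} {i1 i2 j1 j2 n : ℕ} {X : Finset ℕ}
    (h : ∀ p ∈ PosSet i1 i2 j1 j2, ∀ q ∈ PosSet i1 i2 j1 j2, q ∈ X → p ≤ q →
      DistinctBtw a i1 i2 j1 j2 p q → LenBtw i1 i2 j1 j2 p q ≤ n) :
    LDSX a i1 i2 j1 j2 X ≤ n := by
  classical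
  refine Finset.sup_le fun pq hpq => ?_
  simp only [Finset.mem_filter, Finset.mem_product, Finset.mem_inter] at hpq
  exact h _ hpq.1.1 _ hpq.1.2.2 hpq.1.2.1 hpq.2.1 hpq.2.2

theorem le_BLDS {α : Type*} {a : ℕ → α} {i1 i2 j1 j2 p q : ℕ}
    (hp : p ∈ PosSet i1 i2 j1 j2) (hq : q ∈ PosSet i1 i2 j1 j2) (hpq : p ≤ q)
    (hc : (p ≤ i2 ∧ i2 ≤ q) ∨ (p ≤ j1 ∧ j1 ≤ q))
    (hd : DistinctBtw a i1 i2 j1 j2 p q) :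
    LenBtw i1 i2 j1 j2 p q ≤ BLDS a i1 i2 j1 j2 := by
  classical
  exact Finset.le_sup (f := fun pq : ℕ × ℕ => LenBtw i1 i2 j1 j2 pq.1 pq.2) (b := (p, q))
    (Finset.mem_filter.2 ⟨Finset.mem_product.2 ⟨hp, hq⟩, hpq, hc, hd⟩)

/-- The maximum in `BLDS` is attained. -/
theorem exists_BLDS_eq {α : Type*} {a : ℕ → α} {i1 i2 j1 j2 : ℕ} (hi : i1 ≤ i2) :
    ∃ p ∈ PosSet i1 i2 j1 j2, ∃ q ∈ PosSet i1 i2 j1 j2, p ≤ q ∧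
      ((p ≤ i2 ∧ i2 ≤ q) ∨ (p ≤ j1 ∧ j1 ≤ q)) ∧ DistinctBtw a i1 i2 j1 j2 p q ∧
      BLDS a i1 i2 j1 j2 = LenBtw i1 i2 j1 j2 p q := by
  classical
  have hmem : i2 ∈ PosSet i1 i2 j1 j2 := mem_PosSet.2 (by omega)
  have hself : DistinctBtw a i1 i2 j1 j2 i2 i2 := distinctBtw_iff.2 (by omega)
  obtain ⟨pq, hpq, heq⟩ := Finset.exists_mem_eq_sup
    ((PosSet i1 i2 j1 j2 ×ˢ PosSet i1 i2 j1 j2).filter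
      (fun pq => pq.1 ≤ pq.2 ∧
        ((pq.1 ≤ i2 ∧ i2 ≤ pq.2) ∨ (pq.1 ≤ j1 ∧ j1 ≤ pq.2)) ∧
        DistinctBtw a i1 i2 j1 j2 pq.1 pq.2))
    ⟨(i2, i2), by simp [hmem, hself]⟩ (fun pq => LenBtw i1 i2 j1 j2 pq.1 pq.2)
  simp only [Finset.mem_filter, Finset.mem_product] at hpq
  refine ⟨pq.1, hpq.1.1, pq.2, hpq.1.2, hpq.2.1, hpq.2.2.1, hpq.2.2.2, ?_⟩
  rw [← heq, BLDS]

theorem Lfun_le {α : Type*} {a : ℕ → α} {i1 i2 j1 j2 p k : ℕ}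
    (hp : p ∈ PosSet i1 i2 j1 j2) (hpk : p ≤ k) (hd : DistinctBtw a i1 i2 j1 j2 p k) :
    Lfun a i1 i2 j1 j2 k ≤ p :=
  Nat.sInf_le ⟨hp, hpk, hd⟩

theorem Lfun_spec {α : Type*} {a : ℕ → α} {i1 i2 j1 j2 k : ℕ} (hk : k ∈ PosSet i1 i2 j1 j2) :
    Lfun a i1 i2 j1 j2 k ∈ PosSet i1 i2 j1 j2 ∧ Lfun a i1 i2 j1 j2 k ≤ k ∧
      DistinctBtw a i1 i2 j1 j2 (Lfun a i1 i2 j1 j2 k) k :=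
  Nat.sInf_mem (s := {p : ℕ | p ∈ PosSet i1 i2 j1 j2 ∧ p ≤ k ∧ DistinctBtw a i1 i2 j1 j2 p k})
    ⟨k, hk, le_rfl, distinctBtw_iff.2 (by omega)⟩

theorem bddAbove_distinct {α : Type*} (a : ℕ → α) (i1 i2 j1 j2 k : ℕ) :
    BddAbove {q : ℕ | q ∈ PosSet i1 i2 j1 j2 ∧ k ≤ q ∧ DistinctBtw a i1 i2 j1 j2 k q} :=
  (PosSet i1 i2 j1 j2).bddAbove.mono fun _ h => h.1

theorem le_Rfun {α : Type*} {a : ℕ → α} {i1 i2 j1 j2 k q : ℕ}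
    (hq : q ∈ PosSet i1 i2 j1 j2) (hkq : k ≤ q) (hd : DistinctBtw a i1 i2 j1 j2 k q) :
    q ≤ Rfun a i1 i2 j1 j2 k :=
  le_csSup (bddAbove_distinct a i1 i2 j1 j2 k) ⟨hq, hkq, hd⟩

theorem Rfun_spec {α : Type*} {a : ℕ → α} {i1 i2 j1 j2 k : ℕ} (hk : k ∈ PosSet i1 i2 j1 j2) :
    DistinctBtw a i1 i2 j1 j2 k (Rfun a i1 i2 j1 j2 k) :=
  (Nat.sSup_mem
    (s := {q : ℕ | q ∈ PosSet i1 i2 j1 j2 ∧ k ≤ q ∧ DistinctBtw a i1 i2 j1 j2 k q})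
    ⟨k, hk, le_rfl, distinctBtw_iff.2 (by omega)⟩ (bddAbove_distinct a i1 i2 j1 j2 k)).2.2

theorem stmt1 {α : Type*} (a : ℕ → α) (N i1 i2 j1 j2 k1 k2 t i1' i2' k2' : ℕ)
    (Kp : Finset ℕ)
    (hi1 : 1 ≤ i1) (hi12 : i1 ≤ i2) (hij : i2 < j1) (hj12 : j1 ≤ j2) (hj2N : j2 ≤ N)
    (hdist : DistinctBtw a i1 i2 j1 j2 i2 j2)
    (hk1 : j1 ≤ k1) (hk12 : k1 ≤ k2) (hk2 : k2 ≤ j2)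
    (ht : t = k2 - k1 + 1)
    (hKp : Kp = insert (prevP i2 j1 k1) (Finset.Icc k1 k2))
    (hi1' : i1' = Lfun a i1 i2 j1 j2 (prevP i2 j1 k1))
    (hi2' : i2' = min i2 (i1' + t - 1))
    (hk2' : k2' = min k2 (Rfun a i1 i2 j1 j2 (succP i2 j1 i2')))
    (hk1k2' : k1 ≤ k2') :
    LDSX a i1 i2 j1 j2 Kp = (i2 - i2') + (k1 - j1) + BLDS a i1' i2' k1 k2' := by
  obtain ⟨x, hx⟩ : ∃ x, x = prevP i2 j1 k1 := ⟨_, rfl⟩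
  obtain ⟨s, hs⟩ : ∃ s, s = succP i2 j1 i2' := ⟨_, rfl⟩
  rw [← hx] at hKp hi1'
  rw [← hs] at hk2'
  have hx' : (k1 = j1 ∧ x = i2) ∨ (j1 < k1 ∧ x + 1 = k1) := by
    rw [hx, prevP]; split_ifs <;> omega
  have hs' : (i2' = i2 ∧ s = j1) ∨ (i2' ≠ i2 ∧ s = i2' + 1) := by
    rw [hs, succP]; split_ifs <;> omega
  have hxmem : x ∈ PosSet i1 i2 j1 j2 := mem_PosSet.2 (by omega)
  obtain ⟨hLmem, hLx, hLd⟩ := Lfun_spec (a := a) hxmem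
  have hLle : i1' ≤ i2 := hi1' ▸ Lfun_le (mem_PosSet.2 (by omega)) (by omega)
    (hdist.mono le_rfl (by omega))
  rw [← hi1'] at hLmem hLx hLd
  have hi1i1' : i1 ≤ i1' := by rw [mem_PosSet] at hLmem; omega
  have hsmem : s ∈ PosSet i1 i2 j1 j2 := mem_PosSet.2 (by omega)
  have hRd : DistinctBtw a i1 i2 j1 j2 s k2' :=
    (Rfun_spec hsmem).mono le_rfl (hk2' ▸ min_le_right _ _)
  have hk2'le : k2' ≤ k2 := hk2' ▸ min_le_left _ _
  have hleL : ∀ p ∈ PosSet i1 i2 j1 j2, p ≤ x → DistinctBtw a i1 i2 j1 j2 p x → i1' ≤ p := by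
    intro p hp hpx hd
    exact hi1' ▸ Lfun_le hp hpx hd
  have hleR : ∀ q, k1 ≤ q → q ≤ k2 → DistinctBtw a i1 i2 j1 j2 s q → q ≤ k2' := by
    intro q h1 h2 hd
    rw [hk2']
    exact le_min h2 (le_Rfun (mem_PosSet.2 (by omega)) (by omega) hd)
  have hi2c : i1' ≤ i2' ∧ i2' ≤ i2 ∧ (i2' = i2 ∨ i2' + 1 = i1' + (k2 - k1 + 1)) := by omega
  clear hk2' hi2' hi1' ht hx hs hj2N
  have hJ : i2' < k1 := by omega
  have hsub : PosSet i1' i2' k1 k2' ⊆ PosSet i1 i2 j1 j2 := by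
    intro u
    rw [mem_PosSet, mem_PosSet]
    omega
  have hBpre : LenBtw i1' i2' k1 k2' i1' i2' ≤ BLDS a i1' i2' k1 k2' :=
    le_BLDS (mem_PosSet.2 (by omega)) (mem_PosSet.2 (by omega)) (by omega) (by omega)
      ((hLd.mono le_rfl (by omega)).of_subset hsub)
  have hBsuf : LenBtw i1' i2' k1 k2' k1 k2' ≤ BLDS a i1' i2' k1 k2' :=
    le_BLDS (mem_PosSet.2 (by omega)) (mem_PosSet.2 (by omega)) (by omega) (by omega)
      ((hRd.mono (by omega) le_rfl).of_subset hsub)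
  have hlenpre := LenBtw_cases (i1 := i1') (j2 := k2') (p := i1') (q := i2') hJ (mem_PosSet.2 (by omega))
    (mem_PosSet.2 (by omega)) (by omega)
  have hlensuf := LenBtw_cases (i1 := i1') (j2 := k2') (p := k1) (q := k2') hJ (mem_PosSet.2 (by omega))
    (mem_PosSet.2 (by omega)) hk1k2'
  have hBpre' : i2' + 1 ≤ BLDS a i1' i2' k1 k2' + i1' := by omega
  have hBsuf' : k2' + 1 ≤ BLDS a i1' i2' k1 k2' + k1 := by omega
  clear hlenpre hlensuf hBpre hBsuf
  apply le_antisymm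
  · apply LDSX_le
    intro p hp q hq hqK hpq hd
    have hlen := LenBtw_cases hij hp hq hpq
    have hqK' : q = x ∨ (k1 ≤ q ∧ q ≤ k2) := by simpa [hKp] using hqK
    have hLp : i1' ≤ p := by
      by_cases hpx : p ≤ x
      · exact hleL p hp hpx (hd.mono le_rfl (by omega))
      · omega
    rw [mem_PosSet] at hp hq
    rcases hqK' with rfl | ⟨hk1q, hqk2⟩
    · omega
    · by_cases hpi : p ≤ i2'
      · have hqk2' : q ≤ k2' := hleR q hk1q hqk2 (hd.mono (by omega) le_rfl)
        have hB : LenBtw i1' i2' k1 k2' p q ≤ BLDS a i1' i2' k1 k2' :=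
          le_BLDS (mem_PosSet.2 (by omega)) (mem_PosSet.2 (by omega)) hpq (by omega)
            (hd.of_subset hsub)
        have hlenJ := LenBtw_cases (i1 := i1') (j2 := k2') (p := p) (q := q) hJ (mem_PosSet.2 (by omega))
          (mem_PosSet.2 (by omega)) hpq
        omega
      · by_cases hi : i2' = i2
        · have : k2 ≤ k2' := hleR k2 hk12 le_rfl (hdist.mono (by omega) hk2)
          omega
        · omega
  · obtain ⟨p, hp, q, hq, hpq, hc, hd, hB⟩ :=
      exists_BLDS_eq (a := a) (i1 := i1') (i2 := i2') (j1 := k1) (j2 := k2') (by omega)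
    rw [hB]
    have hlenJ := LenBtw_cases hJ hp hq hpq
    clear hB hBpre' hBsuf'
    rw [mem_PosSet] at hp hq
    by_cases hpi : p ≤ i2'
    · by_cases hqk : k1 ≤ q
      · have hle := le_LDSX (a := a) (i1 := i1) (i2 := i2) (j1 := j1) (j2 := j2) (p := p) (q := q)
          (X := Kp) (mem_PosSet.2 (by omega)) (mem_PosSet.2 (by omega))
          (by simp only [hKp, Finset.mem_insert, Finset.mem_Icc]; omega) hpq
          (DistinctBtw.glue (x := s) (y := x) (hLd.mono (by omega) le_rfl)
            (hRd.mono le_rfl (by omega)) hd (by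
              intro u hu
              rw [mem_PosSet] at hu ⊢
              omega))
        have hlen := LenBtw_cases (i1 := i1) (j2 := j2) (p := p) (q := q) hij (mem_PosSet.2 (by omega))
          (mem_PosSet.2 (by omega)) (by omega)
        omega
      · have hle := le_LDSX (a := a) (i1 := i1) (i2 := i2) (j1 := j1) (j2 := j2) (p := p) (q := x)
          (X := Kp) (mem_PosSet.2 (by omega)) hxmem (by simp [hKp]) (by omega)
          (hLd.mono (by omega) le_rfl)
        have hlen := LenBtw_cases (i1 := i1) (j2 := j2) (p := p) (q := x) hij (mem_PosSet.2 (by omega))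
          (mem_PosSet.2 (by omega)) (by omega)
        omega
    · have hle := le_LDSX (a := a) (i1 := i1) (i2 := i2) (j1 := j1) (j2 := j2) (p := s) (q := q)
        (X := Kp) hsmem (mem_PosSet.2 (by omega))
        (by simp only [hKp, Finset.mem_insert, Finset.mem_Icc]; omega) (by omega)
        (hRd.mono le_rfl (by omega))
      have hlen := LenBtw_cases (i1 := i1) (j2 := j2) (p := s) (q := q) hij (mem_PosSet.2 (by omega))
        (mem_PosSet.2 (by omega)) (by omega)
      omega
end

section
/- For every array A of n integers, where n = 2^m with m ≥ 1: max_{1 ≤ i < j ≤ n} (A_j − A_i) = max over t ∈ {0,…,m−1} and k ∈ {1,…,2^t} of ( max_{j ∈ R(t,k)} A_j − min_{i ∈ L(t,k)} A_i ). -/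
/-- The left half `L(t,k)` of the dyadic interval `C(t,k)` of `{1,…,2^m}`. -/
def dyL (m t k : ℕ) : Set ℕ :=
  Set.Icc ((k - 1) * 2 ^ m / 2 ^ t + 1) ((2 * k - 1) * 2 ^ m / 2 ^ (t + 1))

/-- The right half `R(t,k)` of the dyadic interval `C(t,k)` of `{1,…,2^m}`. -/
def dyR (m t k : ℕ) : Set ℕ :=
  Set.Icc ((2 * k - 1) * 2 ^ m / 2 ^ (t + 1) + 1) (k * 2 ^ m / 2 ^ t)

/-- Two distinct naturals are separated by the two halves of a common dyadic interval. -/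
theorem exists_dyadic_separation (a b : ℕ) (hab : a < b) :
    ∃ s q : ℕ, 2 * q * 2 ^ s ≤ a ∧ a < (2 * q + 1) * 2 ^ s ∧
      (2 * q + 1) * 2 ^ s ≤ b ∧ b < (2 * q + 2) * 2 ^ s := by
  induction b using Nat.strong_induction_on generalizing a with
  | _ b ih =>
    by_cases h : a / 2 = b / 2
    · exact ⟨0, a / 2, by omega, by omega, by omega, by omega⟩
    · obtain ⟨s, q, h₁, h₂, h₃, h₄⟩ := ih (b / 2) (by omega) (a / 2) (by omega)
      refine ⟨s + 1, q, ?_, ?_, ?_, ?_⟩ <;> rw [pow_succ, ← mul_assoc] <;> omega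

theorem dyL_eq_Icc (s t q : ℕ) :
    dyL (t + 1 + s) t (q + 1) = Set.Icc (2 * q * 2 ^ s + 1) ((2 * q + 1) * 2 ^ s) := by
  have h₁ : q * 2 ^ (t + 1 + s) = 2 * q * 2 ^ s * 2 ^ t := by ring
  have h₂ : (2 * q + 1) * 2 ^ (t + 1 + s) = (2 * q + 1) * 2 ^ s * 2 ^ (t + 1) := by ring
  rw [dyL, Nat.add_sub_cancel, show 2 * (q + 1) - 1 = 2 * q + 1 by omega, h₁, h₂,
    Nat.mul_div_cancel _ (by positivity), Nat.mul_div_cancel _ (by positivity)]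

theorem dyR_eq_Icc (s t q : ℕ) :
    dyR (t + 1 + s) t (q + 1) = Set.Icc ((2 * q + 1) * 2 ^ s + 1) ((2 * q + 2) * 2 ^ s) := by
  have h₁ : (q + 1) * 2 ^ (t + 1 + s) = (2 * q + 2) * 2 ^ s * 2 ^ t := by ring
  have h₂ : (2 * q + 1) * 2 ^ (t + 1 + s) = (2 * q + 1) * 2 ^ s * 2 ^ (t + 1) := by ring
  rw [dyR, show 2 * (q + 1) - 1 = 2 * q + 1 by omega, h₁, h₂,
    Nat.mul_div_cancel _ (by positivity), Nat.mul_div_cancel _ (by positivity)]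

/-- For every array `A` of `n = 2^m` integers,
`max_{1 ≤ i < j ≤ n} (A_j − A_i)` equals the maximum over `t ∈ {0,…,m−1}` and
`k ∈ {1,…,2^t}` of `max_{j ∈ R(t,k)} A_j − min_{i ∈ L(t,k)} A_i`. -/
theorem stmt4 (m : ℕ) (hm : 1 ≤ m) (A : ℕ → ℤ) :
    sSup {z : ℤ | ∃ i j : ℕ, 1 ≤ i ∧ i < j ∧ j ≤ 2 ^ m ∧ z = A j - A i} =
      sSup {z : ℤ | ∃ t k : ℕ, t ≤ m - 1 ∧ 1 ≤ k ∧ k ≤ 2 ^ t ∧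
        z = sSup (A '' dyR m t k) - sInf (A '' dyL m t k)} := by
  set S := {z : ℤ | ∃ i j : ℕ, 1 ≤ i ∧ i < j ∧ j ≤ 2 ^ m ∧ z = A j - A i}
  set T := {z : ℤ | ∃ t k : ℕ, t ≤ m - 1 ∧ 1 ≤ k ∧ k ≤ 2 ^ t ∧
    z = sSup (A '' dyR m t k) - sInf (A '' dyL m t k)}
  have finite_image (a b : ℕ) : (A '' Set.Icc a b).Finite := (Set.finite_Icc a b).image A
  have hS : BddAbove S := by
    refine (((Set.finite_Icc 1 (2 ^ m)).prod (Set.finite_Icc 1 (2 ^ m))).image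
      fun p : ℕ × ℕ => A p.2 - A p.1).bddAbove.mono ?_
    rintro z ⟨i, j, hi, hij, hj, rfl⟩
    exact ⟨(i, j), ⟨⟨hi, by omega⟩, ⟨by omega, hj⟩⟩, rfl⟩
  have hTS : T ⊆ S := by
    rintro z ⟨t, k, ht, hk, hkt, rfl⟩
    obtain ⟨s, rfl⟩ : ∃ s, m = t + 1 + s := ⟨m - (t + 1), by omega⟩
    obtain ⟨q, rfl⟩ : ∃ q, k = q + 1 := ⟨k - 1, by omega⟩
    rw [dyL_eq_Icc, dyR_eq_Icc]
    have hs : 0 < 2 ^ s := by positivity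
    obtain ⟨i, hi, hi_inf⟩ := Set.Nonempty.csInf_mem
      ((Set.nonempty_Icc.2 (by linarith :
        2 * q * 2 ^ s + 1 ≤ (2 * q + 1) * 2 ^ s)).image A) (finite_image _ _)
    obtain ⟨j, hj, hj_sup⟩ := Set.Nonempty.csSup_mem
      ((Set.nonempty_Icc.2 (by linarith :
        (2 * q + 1) * 2 ^ s + 1 ≤ (2 * q + 2) * 2 ^ s)).image A) (finite_image _ _)
    refine ⟨i, j, by have := hi.1; omega, by have := hi.2; have := hj.1; omega, ?_, ?_⟩
    · calc j ≤ (2 * q + 2) * 2 ^ s := hj.2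
        _ = (q + 1) * 2 ^ (s + 1) := by ring
        _ ≤ 2 ^ t * 2 ^ (s + 1) := Nat.mul_le_mul_right _ hkt
        _ = 2 ^ (t + 1 + s) := by ring
    · rw [hi_inf, hj_sup]
  apply le_antisymm
  · have hm₂ : 2 ≤ 2 ^ m := Nat.le_self_pow (by omega) 2
    refine csSup_le ⟨_, 1, 2, le_rfl, by omega, hm₂, rfl⟩ ?_
    rintro z ⟨i, j, hi, hij, hj, rfl⟩
    obtain ⟨s, q, h₁, h₂, h₃, h₄⟩ := exists_dyadic_separation (i - 1) (j - 1) (by omega)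
    have hsm : s < m := by
      refine (Nat.pow_lt_pow_iff_right (by norm_num : 1 < 2)).1 ?_
      calc 2 ^ s ≤ (2 * q + 1) * 2 ^ s := Nat.le_mul_of_pos_left _ (by omega)
        _ ≤ j - 1 := h₃
        _ < 2 ^ m := by omega
    obtain ⟨t, rfl⟩ : ∃ t, m = t + 1 + s := ⟨m - (s + 1), by omega⟩
    have hq : q + 1 ≤ 2 ^ t := by
      have : (2 * q + 1) * 2 ^ s < 2 ^ (t + 1) * 2 ^ s := by rw [← pow_add]; omega
      have := Nat.lt_of_mul_lt_mul_right this
      rw [pow_succ] at this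
      omega
    refine le_csSup_of_le (hS.mono hTS) ⟨t, q + 1, by omega, by omega, hq, rfl⟩ ?_
    rw [dyL_eq_Icc, dyR_eq_Icc]
    exact sub_le_sub
      (le_csSup (finite_image _ _).bddAbove ⟨j, ⟨by omega, by omega⟩, rfl⟩)
      (csInf_le (finite_image _ _).bddBelow ⟨i, ⟨by omega, by omega⟩, rfl⟩)
  · exact csSup_le_csSup hS ⟨_, 0, 1, by omega, le_rfl, by simp, rfl⟩ hTS
end

section
/- Let a ∈ Σ^n with n = 2^m, m ≥ 1. For t ∈ {0,…,m−1} and k ∈ {1,…,2^t}, let mid(t,k) = (2k−1)·n/2^{t+1} and let P(a,t,k) be the maximum of j − i + 1 over all pairs i ≤ j with i, j ∈ C(t,k), i ≤ mid(t,k)+1, j ≥ mid(t,k), and a[i:j] distinct (0 if no such pair exists). Then LDS(a) = max over all t ∈ {0,…,m−1} and k ∈ {1,…,2^t} of P(a,t,k). -/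
/-- The midpoint `mid(t,k) = (2k−1)·n/2^{t+1}` of the dyadic interval `C(t,k)`
of `{1,…,2^m}`. -/
def dyMid (m t k : ℕ) : ℕ := (2 * k - 1) * 2 ^ m / 2 ^ (t + 1)

open Classical in
/-- `P(a,t,k)`: the maximum of `j − i + 1` over all pairs `i ≤ j` with
`i, j ∈ C(t,k)`, `i ≤ mid(t,k)+1`, `j ≥ mid(t,k)`, and `a[i:j]` distinct
(`0` if no such pair exists). -/
noncomputable def Pcross {α : Type*} (a : ℕ → α) (m t k : ℕ) : ℕ :=
  ((Finset.Icc ((k - 1) * 2 ^ m / 2 ^ t + 1) (k * 2 ^ m / 2 ^ t) ×ˢ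
      Finset.Icc ((k - 1) * 2 ^ m / 2 ^ t + 1) (k * 2 ^ m / 2 ^ t)).filter
      (fun p => p.1 ≤ p.2 ∧ p.1 ≤ dyMid m t k + 1 ∧ dyMid m t k ≤ p.2 ∧
        DistinctOn a p.1 p.2)).sup fun p => p.2 - p.1 + 1

/-- Any interval inside a block of length `2 ^ (d + 1)` lies in some dyadic sub-block whose
midpoint it crosses or touches. -/
theorem exists_dyadic_crossing {i j : ℕ} (hij : i ≤ j) (d c : ℕ) (hi : c * 2 ^ (d + 1) < i)
    (hj : j ≤ (c + 1) * 2 ^ (d + 1)) :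
    ∃ s ≤ d, ∃ b, b * 2 ^ (s + 1) < i ∧ j ≤ (b + 1) * 2 ^ (s + 1) ∧
      i ≤ (2 * b + 1) * 2 ^ s + 1 ∧ (2 * b + 1) * 2 ^ s ≤ j := by
  induction d generalizing c with
  | zero => exact ⟨0, le_rfl, c, hi, hj, by omega, by omega⟩
  | succ d ih =>
    by_cases hleft : j < (2 * c + 1) * 2 ^ (d + 1)
    · obtain ⟨s, hs, h⟩ := ih (2 * c) (by rw [pow_succ] at hi; linarith) hleft.le
      exact ⟨s, by omega, h⟩
    by_cases hright : (2 * c + 1) * 2 ^ (d + 1) + 1 < i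
    · obtain ⟨s, hs, h⟩ := ih (2 * c + 1) (by omega) (by rw [pow_succ] at hj; linarith)
      exact ⟨s, by omega, h⟩
    exact ⟨d + 1, le_rfl, c, hi, hj, by omega, by omega⟩

theorem mul_two_pow_add_div (x s t : ℕ) : x * 2 ^ (s + t) / 2 ^ t = x * 2 ^ s := by
  rw [pow_add, ← mul_assoc, Nat.mul_div_cancel _ (by positivity)]

/-- `LDS(a) = max_{t ∈ {0,…,m−1}, k ∈ {1,…,2^t}} P(a,t,k)`. -/
theorem stmt5 {α : Type*} (a : ℕ → α) (m : ℕ) (hm : 1 ≤ m) :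
    LDS a (2 ^ m) =
      (Finset.range m).sup fun t => (Finset.Icc 1 (2 ^ t)).sup fun k => Pcross a m t k := by
  apply le_antisymm
  · refine Finset.sup_le fun p hp => ?_
    simp only [Finset.mem_filter, Finset.mem_product, Finset.mem_Icc] at hp
    obtain ⟨⟨⟨hi, -⟩, -, hj⟩, hij, hdistinct⟩ := hp
    obtain ⟨d, rfl⟩ : ∃ d, m = d + 1 := ⟨m - 1, by omega⟩
    obtain ⟨s, hs, b, hbi, hbj, hmi, hmj⟩ :=
      exists_dyadic_crossing hij d 0 (by omega) (by simpa using hj)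
    obtain ⟨t, rfl⟩ := Nat.exists_eq_add_of_le hs
    have hlen : s + t + 1 = s + 1 + t := by omega
    have hb : b < 2 ^ t := by
      have h : b * 2 ^ (s + 1) < 2 ^ t * 2 ^ (s + 1) := by
        rw [← pow_add, show t + (s + 1) = s + t + 1 by omega]
        omega
      exact lt_of_mul_lt_mul_right h (Nat.zero_le _)
    have hmid : dyMid (s + t + 1) t (b + 1) = (2 * b + 1) * 2 ^ s := by
      rw [dyMid, add_assoc, mul_two_pow_add_div]
      rfl
    refine le_trans ?_ (Finset.le_sup (b := t) (by simp))
    refine le_trans ?_ (Finset.le_sup (b := b + 1) (by simp; omega))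
    refine Finset.le_sup (f := fun p : ℕ × ℕ => p.2 - p.1 + 1) ?_
    rw [hmid, hlen, mul_two_pow_add_div, mul_two_pow_add_div, Nat.add_sub_cancel]
    simp only [Finset.mem_filter, Finset.mem_product, Finset.mem_Icc]
    exact ⟨⟨⟨by omega, by omega⟩, by omega, hbj⟩, hij, hmi, hmj, hdistinct⟩
  · refine Finset.sup_le fun t _ => Finset.sup_le fun k hk => Finset.sup_mono fun p hp => ?_
    have hbound : k * 2 ^ m / 2 ^ t ≤ 2 ^ m :=
      Nat.div_le_of_le_mul (Nat.mul_le_mul_right _ (Finset.mem_Icc.mp hk).2)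
    simp only [Finset.mem_filter, Finset.mem_product, Finset.mem_Icc] at hp ⊢
    obtain ⟨⟨⟨hi, hi'⟩, hj, hj'⟩, hij, -, -, hdistinct⟩ := hp
    exact ⟨⟨⟨(Nat.le_add_left _ _).trans hi, hi'.trans hbound⟩,
      (Nat.le_add_left _ _).trans hj, hj'.trans hbound⟩, hij, hdistinct⟩
end

section
/- Define i* = l if A_i < A_{i+1} for all l ≤ i ≤ m, and i* = 1 + max{ i : l ≤ i ≤ m, A_i ≥ A_{i+1} } otherwise; define j* = r if A_{j−1} < A_j for all m+1 ≤ j ≤ r, and j* = min{ j : m+1 ≤ j ≤ r, A_j ≤ A_{j−1} } − 1 otherwise. Then the maximum of j − i + 1 over all pairs l ≤ i ≤ m < j ≤ r such that A[i:j] is strictly increasing (taken to be 0 if there is no such pair) equals j* − i* + 1. -/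
open Classical in
/-- The start of the longest strictly increasing run `l ≤ i ≤ ⋯ ≤ m + 1` that reaches `m + 1`. -/
theorem runStart_spec (A : ℕ → ℤ) {l m : ℕ} (hlm : l ≤ m) {i : ℕ}
    (hi : i = if ∀ i ∈ Finset.Icc l m, A i < A (i + 1) then l
      else 1 + sSup {i : ℕ | i ∈ Finset.Icc l m ∧ A (i + 1) ≤ A i}) :
    l ≤ i ∧ i ≤ m + 1 ∧ (∀ u, i ≤ u → u ≤ m → A u < A (u + 1)) ∧
      (i = l ∨ ∃ k, i = k + 1 ∧ l ≤ k ∧ A (k + 1) ≤ A k) := by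
  split_ifs at hi with h
  · subst hi
    exact ⟨le_rfl, by omega, fun u h₁ h₂ => h u (Finset.mem_Icc.2 ⟨h₁, h₂⟩), Or.inl rfl⟩
  · set S := {i : ℕ | i ∈ Finset.Icc l m ∧ A (i + 1) ≤ A i}
    have hne : S.Nonempty := by
      push Not at h
      exact h
    have hbdd : BddAbove S := ⟨m, fun x hx => (Finset.mem_Icc.1 hx.1).2⟩
    obtain ⟨hmem, hdesc⟩ := Nat.sSup_mem hne hbdd
    rw [Finset.mem_Icc] at hmem
    refine ⟨by omega, by omega, fun u h₁ h₂ => ?_, Or.inr ⟨sSup S, by omega, hmem.1, hdesc⟩⟩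
    by_contra hu
    have : u ≤ sSup S := le_csSup hbdd ⟨Finset.mem_Icc.2 ⟨by omega, h₂⟩, not_lt.1 hu⟩
    omega

open Classical in
/-- The end of the longest strictly increasing run `m ≤ ⋯ ≤ j ≤ r` that starts from `m`. -/
theorem runEnd_spec (A : ℕ → ℤ) {m r : ℕ} (hmr : m < r) {j : ℕ}
    (hj : j = if ∀ j ∈ Finset.Icc (m + 1) r, A (j - 1) < A j then r
      else sInf {j : ℕ | j ∈ Finset.Icc (m + 1) r ∧ A j ≤ A (j - 1)} - 1) :
    m ≤ j ∧ j ≤ r ∧ (∀ u, m ≤ u → u < j → A u < A (u + 1)) ∧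
      (j = r ∨ A (j + 1) ≤ A j) := by
  split_ifs at hj with h
  · subst hj
    exact ⟨hmr.le, le_rfl,
      fun u h₁ h₂ => h (u + 1) (Finset.mem_Icc.2 ⟨by omega, h₂⟩), Or.inl rfl⟩
  · set S := {j : ℕ | j ∈ Finset.Icc (m + 1) r ∧ A j ≤ A (j - 1)}
    have hne : S.Nonempty := by
      push Not at h
      exact h
    obtain ⟨hmem, hdesc⟩ := Nat.sInf_mem hne
    rw [Finset.mem_Icc] at hmem
    refine ⟨by omega, by omega, fun u h₁ h₂ => ?_, Or.inr ?_⟩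
    · by_contra hu
      have : sInf S ≤ u + 1 :=
        Nat.sInf_le ⟨Finset.mem_Icc.2 ⟨by omega, by omega⟩, not_lt.1 hu⟩
      omega
    · rwa [hj, show sInf S - 1 + 1 = sInf S by omega]

open Classical in
/-- Longest strictly increasing substring crossing the
midpoint `m` of the window `{l,…,r}`. -/
theorem stmt6 (n l m r : ℕ) (A : ℕ → ℤ)
    (hl : 1 ≤ l) (hlm : l ≤ m) (hmr : m < r) (hrn : r ≤ n) :
    let istar : ℕ :=
      if ∀ i ∈ Finset.Icc l m, A i < A (i + 1) then l
      else 1 + sSup {i : ℕ | i ∈ Finset.Icc l m ∧ A (i + 1) ≤ A i}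
    let jstar : ℕ :=
      if ∀ j ∈ Finset.Icc (m + 1) r, A (j - 1) < A j then r
      else sInf {j : ℕ | j ∈ Finset.Icc (m + 1) r ∧ A j ≤ A (j - 1)} - 1
    ((((Finset.Icc l m ×ˢ Finset.Icc (m + 1) r).filter
          (fun p => ∀ u, p.1 ≤ u → u < p.2 → A u < A (u + 1))).sup
        fun p => p.2 - p.1 + 1 : ℕ) : ℤ) = (jstar : ℤ) - (istar : ℤ) + 1 := by
  intro istar jstar
  obtain ⟨hli, him, hinci, hmaxi⟩ := runStart_spec A hlm (i := istar) rfl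
  obtain ⟨hmj, hjr, hincj, hmaxj⟩ := runEnd_spec A hmr (j := jstar) (by unfold jstar; congr)
  generalize istar = i at *
  generalize jstar = j at *
  suffices h : ((Finset.Icc l m ×ˢ Finset.Icc (m + 1) r).filter
      (fun p => ∀ u, p.1 ≤ u → u < p.2 → A u < A (u + 1))).sup
      (fun p => p.2 - p.1 + 1) = j + 1 - i by
    rw [h]
    omega
  apply le_antisymm
  · refine Finset.sup_le ?_
    rintro ⟨a, b⟩ hab
    simp only [Finset.mem_filter, Finset.mem_product, Finset.mem_Icc] at hab ⊢
    obtain ⟨⟨⟨hla, ham⟩, hmb, hbr⟩, hinc⟩ := hab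
    have hia : i ≤ a := by
      rcases hmaxi with rfl | ⟨k, rfl, -, hk⟩
      · exact hla
      · by_contra hlt
        exact absurd (hinc k (by omega) (by omega)) (not_lt.2 hk)
    have hbj : b ≤ j := by
      rcases hmaxj with rfl | hk
      · exact hbr
      · by_contra hlt
        exact absurd (hinc j (by omega) (by omega)) (not_lt.2 hk)
    omega
  · by_cases hm : A m < A (m + 1)
    · have him' : i ≤ m := by
        rcases hmaxi with rfl | ⟨k, rfl, -, hk⟩
        · exact hlm
        · by_contra hlt
          obtain rfl : k = m := by omega
          exact absurd hm (not_lt.2 hk)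
      have hmj' : m + 1 ≤ j := by
        rcases hmaxj with rfl | hk
        · exact hmr
        · by_contra hlt
          obtain rfl : j = m := by omega
          exact absurd hm (not_lt.2 hk)
      have hmem : (i, j) ∈ (Finset.Icc l m ×ˢ Finset.Icc (m + 1) r).filter
          (fun p => ∀ u, p.1 ≤ u → u < p.2 → A u < A (u + 1)) := by
        simp only [Finset.mem_filter, Finset.mem_product, Finset.mem_Icc]
        refine ⟨⟨⟨hli, him'⟩, hmj', hjr⟩, fun u h₁ h₂ => ?_⟩
        rcases le_total u m with h | h
        · exact hinci u h₁ h
        · exact hincj u h h₂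
      refine le_trans ?_ (Finset.le_sup (f := fun p : ℕ × ℕ => p.2 - p.1 + 1) hmem)
      dsimp only
      omega
    · have him' : m < i := by
        by_contra h
        exact hm (hinci m (by omega) le_rfl)
      have hmj' : j ≤ m := by
        by_contra h
        exact hm (hincj m le_rfl (by omega))
      omega
end

section
/- For every 1 ≤ p < N, every integer k ≥ 2, and every γ ∈ ℤ ∪ {−∞}: the minimum of A_{i_k} over all tuples i_1 < i_2 < … < i_k of indices in {1,…,N} with γ < A_{i_1} < A_{i_2} < … < A_{i_k} and i_1 ≤ p < i_k (taken to be +∞ if no such tuple exists) equals the minimum over 1 ≤ j ≤ k−1 of F_{k−j}({p+1,…,N}, F_j({1,…,p}, γ)). -/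
/-- `F_k(S, γ)`: the minimum of `A_{i_k}` over all tuples `i_1 < … < i_k` of
indices in `S` with `γ < A_{i_1} < … < A_{i_k}` (`+∞` if no such tuple exists).
The threshold `γ` lives in `ℤ ∪ {−∞, +∞}` (encoded as `WithBot (WithTop ℤ)`),
so that the convention `F_k(S, +∞) = +∞` holds automatically. -/
noncomputable def Fmin (A : ℕ → ℤ) (S : Set ℕ) (k : ℕ) (γ : WithBot (WithTop ℤ)) :
    WithTop ℤ :=
  sInf {z : WithTop ℤ | ∃ hk : 0 < k, ∃ i : Fin k → ℕ, StrictMono i ∧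
    (∀ a, i a ∈ S) ∧ (∀ a b : Fin k, a < b → A (i a) < A (i b)) ∧
    γ < ((A (i ⟨0, hk⟩) : WithTop ℤ) : WithBot (WithTop ℤ)) ∧
    z = (A (i ⟨k - 1, by omega⟩) : WithTop ℤ)}

theorem WithTop.coe_mem_of_sInf_eq {s : Set (WithTop ℤ)} (hs : BddBelow s) {n : ℤ}
    (h : sInf s = n) : (n : WithTop ℤ) ∈ s := by
  have hglb := WithTop.isGLB_sInf' hs
  rw [h] at hglb
  by_contra hn
  have hlow : ((n + 1 : ℤ) : WithTop ℤ) ∈ lowerBounds s := by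
    intro x hx
    have hle := hglb.1 hx
    cases x with
    | top => exact le_top
    | coe x =>
      have hne : x ≠ n := by rintro rfl; exact hn hx
      have hle' : n ≤ x := WithTop.coe_le_coe.1 hle
      exact WithTop.coe_le_coe.2 (by omega)
  have := WithTop.coe_le_coe.1 (hglb.2 hlow)
  omega

theorem Fmin_bddBelow {A : ℕ → ℤ} {S : Set ℕ} {m : ℤ} (hm : ∀ x ∈ S, m ≤ A x) (k : ℕ)
    (γ : WithBot (WithTop ℤ)) :
    (m : WithTop ℤ) ∈ lowerBounds {z : WithTop ℤ | ∃ hk : 0 < k, ∃ i : Fin k → ℕ, StrictMono i ∧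
      (∀ a, i a ∈ S) ∧ (∀ a b : Fin k, a < b → A (i a) < A (i b)) ∧
      γ < ((A (i ⟨0, hk⟩) : WithTop ℤ) : WithBot (WithTop ℤ)) ∧
      z = (A (i ⟨k - 1, by omega⟩) : WithTop ℤ)} := by
  rintro z ⟨hk, i, -, hS, -, -, rfl⟩
  exact WithTop.coe_le_coe.2 (hm _ (hS _))

theorem le_Fmin {A : ℕ → ℤ} {S : Set ℕ} {m : ℤ} (hm : ∀ x ∈ S, m ≤ A x) (k : ℕ)
    (γ : WithBot (WithTop ℤ)) : (m : WithTop ℤ) ≤ Fmin A S k γ :=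
  (WithTop.isGLB_sInf' ⟨_, Fmin_bddBelow hm k γ⟩).2 (Fmin_bddBelow hm k γ)

theorem Fmin_le {A : ℕ → ℤ} {S : Set ℕ} {m : ℤ} (hm : ∀ x ∈ S, m ≤ A x) {k : ℕ}
    {γ : WithBot (WithTop ℤ)} (hk : 0 < k) (i : Fin k → ℕ) (hi : StrictMono i)
    (hS : ∀ a, i a ∈ S) (hA : ∀ a b : Fin k, a < b → A (i a) < A (i b))
    (hγ : γ < ((A (i ⟨0, hk⟩) : WithTop ℤ) : WithBot (WithTop ℤ))) :
    Fmin A S k γ ≤ (A (i ⟨k - 1, by omega⟩) : WithTop ℤ) :=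
  (WithTop.isGLB_sInf' ⟨_, Fmin_bddBelow hm k γ⟩).1 ⟨hk, i, hi, hS, hA, hγ, rfl⟩

theorem exists_of_Fmin_eq {A : ℕ → ℤ} {S : Set ℕ} {m : ℤ} (hm : ∀ x ∈ S, m ≤ A x) {k : ℕ}
    {γ : WithBot (WithTop ℤ)} {n : ℤ} (h : Fmin A S k γ = n) :
    ∃ hk : 0 < k, ∃ i : Fin k → ℕ, StrictMono i ∧
      (∀ a, i a ∈ S) ∧ (∀ a b : Fin k, a < b → A (i a) < A (i b)) ∧
      γ < ((A (i ⟨0, hk⟩) : WithTop ℤ) : WithBot (WithTop ℤ)) ∧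
      n = A (i ⟨k - 1, by omega⟩) := by
  obtain ⟨hk, i, hi, hS, hA, hγ, hn⟩ := WithTop.coe_mem_of_sInf_eq ⟨_, Fmin_bddBelow hm k γ⟩ h
  exact ⟨hk, i, hi, hS, hA, hγ, WithTop.coe_injective hn⟩

/-- A strictly increasing sequence starting at or below `p` and ending above `p` crosses `p`
at exactly one position. -/
theorem StrictMono.exists_crossing {k p : ℕ} (hk : 2 ≤ k) {i : Fin k → ℕ} (hi : StrictMono i)
    (h0 : i ⟨0, by omega⟩ ≤ p) (h1 : p < i ⟨k - 1, by omega⟩) :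
    ∃ j, 1 ≤ j ∧ j ≤ k - 1 ∧ (∀ a : Fin k, a.1 < j → i a ≤ p) ∧
      ∀ a : Fin k, j ≤ a.1 → p < i a := by
  classical
  have hex : ∃ j, ∃ hj : j < k, p < i ⟨j, hj⟩ := ⟨k - 1, by omega, h1⟩
  obtain ⟨hj, hpj⟩ := Nat.find_spec hex
  refine ⟨Nat.find hex, ?_, Nat.find_min' hex ⟨by omega, h1⟩, ?_, ?_⟩
  · rw [Nat.one_le_iff_ne_zero]
    intro h
    simp only [h] at hpj
    omega
  · intro a ha
    by_contra hlt
    exact Nat.find_min hex ha ⟨a.2, by simpa using hlt⟩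
  · intro a ha
    exact hpj.trans_le (hi.monotone (Fin.mk_le_of_le_val ha))

/-- For `1 ≤ p < N`, `k ≥ 2` and `γ ∈ ℤ ∪ {−∞}`, the minimum of
`A_{i_k}` over increasing tuples in `{1,…,N}` with `γ < A_{i_1} < … < A_{i_k}`
and `i_1 ≤ p < i_k` equals
`min_{1 ≤ j ≤ k−1} F_{k−j}({p+1,…,N}, F_j({1,…,p}, γ))`. -/
theorem stmt9 (A : ℕ → ℤ) (N p : ℕ) (hp : 1 ≤ p) (hpN : p < N)
    (k : ℕ) (hk : 2 ≤ k) (γ : WithBot ℤ) :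
    sInf {z : WithTop ℤ | ∃ i : Fin k → ℕ, StrictMono i ∧
        (∀ a, i a ∈ Set.Icc 1 N) ∧
        (∀ a b : Fin k, a < b → A (i a) < A (i b)) ∧
        γ.map (fun x : ℤ => (x : WithTop ℤ)) <
          ((A (i ⟨0, by omega⟩) : WithTop ℤ) : WithBot (WithTop ℤ)) ∧
        i ⟨0, by omega⟩ ≤ p ∧ p < i ⟨k - 1, by omega⟩ ∧
        z = (A (i ⟨k - 1, by omega⟩) : WithTop ℤ)} =
      sInf {z : WithTop ℤ | ∃ j : ℕ, 1 ≤ j ∧ j ≤ k - 1 ∧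
        z = Fmin A (Set.Icc (p + 1) N) (k - j)
              ((Fmin A (Set.Icc 1 p) j (γ.map (fun x : ℤ => (x : WithTop ℤ)))
                : WithTop ℤ) : WithBot (WithTop ℤ))} := by
  obtain ⟨m, hm⟩ : ∃ m, ∀ x ∈ Set.Icc 1 N, m ≤ A x := by
    obtain ⟨m, hm⟩ := ((Set.finite_Icc 1 N).image A).bddBelow
    exact ⟨m, fun x hx => hm ⟨x, hx, rfl⟩⟩
  have hm₁ : ∀ x ∈ Set.Icc 1 p, m ≤ A x := fun x hx => hm x ⟨hx.1, hx.2.trans hpN.le⟩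
  have hm₂ : ∀ x ∈ Set.Icc (p + 1) N, m ≤ A x := fun x hx => hm x ⟨by grind, hx.2⟩
  generalize γ.map (fun x : ℤ => (x : WithTop ℤ)) = γ'
  apply le_antisymm
  · refine (WithTop.isGLB_sInf' ⟨(m : WithTop ℤ), ?_⟩).2 ?_
    · rintro _ ⟨j, -, -, rfl⟩
      exact le_Fmin hm₂ _ _
    rintro _ ⟨j, hj, hjk, rfl⟩
    cases hF : Fmin A (Set.Icc (p + 1) N) (k - j) (Fmin A (Set.Icc 1 p) j γ' : WithTop ℤ) with
    | top => exact le_top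
    | coe n =>
    obtain ⟨hk', v, hv, hvS, hvA, hvγ, rfl⟩ := exists_of_Fmin_eq hm₂ hF
    rw [WithBot.coe_lt_coe] at hvγ
    cases hG : Fmin A (Set.Icc 1 p) j γ' with
    | top => simp [hG] at hvγ
    | coe q =>
    rw [hG, WithTop.coe_lt_coe] at hvγ
    obtain ⟨hj', u, hu, huS, huA, huγ, rfl⟩ := exists_of_Fmin_eq hm₁ hG
    have hu_last : ∀ a, A (u a) ≤ A (u ⟨j - 1, by omega⟩) := fun a => by
      rcases (show a ≤ ⟨j - 1, by omega⟩ from Fin.le_def.2 (by grind)).eq_or_lt with h | h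
      · rw [h]
      · exact (huA _ _ h).le
    have hv_first : ∀ a, A (v ⟨0, hk'⟩) ≤ A (v a) := fun a => by
      rcases (show ⟨0, hk'⟩ ≤ a from Fin.le_def.2 (Nat.zero_le _)).eq_or_lt with h | h
      · rw [h]
      · exact (hvA _ _ h).le
    refine (WithTop.isGLB_sInf' ⟨(m : WithTop ℤ), ?_⟩).1
      ⟨fun a => if h : a.1 < j then u ⟨a, h⟩ else v ⟨a - j, by omega⟩, ?_, ?_, ?_, ?_, ?_, ?_, ?_⟩
    · rintro _ ⟨i, -, hS, -, -, -, -, rfl⟩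
      exact WithTop.coe_le_coe.2 (hm _ (hS _))
    · intro a b hab
      rw [Fin.lt_def] at hab
      dsimp only
      split_ifs with ha hb hb
      · exact hu (Fin.mk_lt_mk.2 hab)
      · exact (huS _).2.trans_lt (hvS _).1
      · omega
      · exact hv (Fin.mk_lt_mk.2 (by omega))
    · intro a
      dsimp only
      split_ifs with ha
      · exact ⟨(huS _).1, (huS _).2.trans hpN.le⟩
      · exact ⟨by have := (hvS ⟨a - j, by omega⟩).1; omega, (hvS _).2⟩
    · intro a b hab
      rw [Fin.lt_def] at hab
      dsimp only
      split_ifs with ha hb hb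
      · exact huA _ _ (Fin.mk_lt_mk.2 hab)
      · exact (hu_last _).trans_lt (hvγ.trans_le (hv_first _))
      · omega
      · exact hvA _ _ (Fin.mk_lt_mk.2 (by omega))
    · simpa [hj'] using huγ
    · simpa [hj'] using (huS _).2
    · dsimp only
      rw [dif_neg (by omega)]
      exact (hvS _).1
    · dsimp only
      rw [dif_neg (by omega)]
      simp only [Nat.sub_right_comm]
  · refine (WithTop.isGLB_sInf' ⟨(m : WithTop ℤ), ?_⟩).2 ?_
    · rintro _ ⟨i, -, hS, -, -, -, -, rfl⟩
      exact WithTop.coe_le_coe.2 (hm _ (hS _))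
    rintro _ ⟨i, hi, hS, hA, hγ, h0, h1, rfl⟩
    obtain ⟨j, hj, hjk, hlo, hhi⟩ := hi.exists_crossing hk h0 h1
    have hfirst := Fmin_le hm₁ (γ := γ') hj (fun a => i ⟨a, by omega⟩)
      (fun a b hab => hi hab) (fun a => ⟨(hS _).1, hlo _ a.2⟩)
      (fun a b hab => hA _ _ hab) hγ
    have hlast := Fmin_le hm₂ (k := k - j)
      (γ := (Fmin A (Set.Icc 1 p) j γ' : WithTop ℤ)) (by omega)
      (fun a => i ⟨a + j, by omega⟩)
      (fun a b hab => hi (Fin.mk_lt_mk.2 (Nat.add_lt_add_right hab j)))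
      (fun a => ⟨hhi _ (Nat.le_add_left _ _), (hS _).2⟩)
      (fun a b hab => hA _ _ (Fin.mk_lt_mk.2 (Nat.add_lt_add_right hab j)))
      (WithBot.coe_lt_coe.2 (hfirst.trans_lt (WithTop.coe_lt_coe.2
        (hA _ _ (Fin.mk_lt_mk.2 (by simp only; omega))))))
    have hidx : k - j - 1 + j = k - 1 := by omega
    simp only [hidx] at hlast
    refine le_trans ((WithTop.isGLB_sInf' ⟨(m : WithTop ℤ), ?_⟩).1 ⟨j, hj, hjk, rfl⟩) hlast
    rintro _ ⟨j, -, -, rfl⟩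
    exact le_Fmin hm₂ _ _
end

section
/- Define the (2n+1) × (2n+1) integer matrix C by: C(u,v) = x(u,v) for 1 ≤ u,v ≤ n; C(u, n+1) = −(n+1) for 1 ≤ u ≤ n; C(u, n+1+v) = D(u,v) for 1 ≤ u,v ≤ n; and C(u,v) = −1 for all n+1 ≤ u ≤ 2n+1 and 1 ≤ v ≤ 2n+1. Then max_{1 ≤ i ≤ j ≤ 2n+1, 1 ≤ k ≤ ℓ ≤ 2n+1} Σ_{i ≤ u ≤ j, k ≤ v ≤ ℓ} C(u,v) = max( Σ_{1 ≤ u,v ≤ n} x(u,v), ⌊n²/2⌋ ). In particular, this maximum submatrix sum exceeds ⌊n²/2⌋ if and only if Σ_{1 ≤ u,v ≤ n} x(u,v) > ⌊n²/2⌋. -/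
theorem Finset.sum_le_sum_of_nonpos_of_nonneg {ι : Type*} {s t : Finset ι} {f g : ι → ℤ}
    (hfg : ∀ a ∈ s, a ∈ t → f a ≤ g a) (hf : ∀ a ∈ s, a ∉ t → f a ≤ 0)
    (hg : ∀ a ∈ t, 0 ≤ g a) : ∑ a ∈ s, f a ≤ ∑ a ∈ t, g a := by
  classical
  calc ∑ a ∈ s, f a ≤ ∑ a ∈ s, if a ∈ t then g a else 0 := by
        refine Finset.sum_le_sum fun a ha => ?_
        split_ifs with h
        · exact hfg a ha h
        · exact hf a ha h
    _ = ∑ a ∈ s with a ∈ t, g a := (Finset.sum_filter _ _).symm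
    _ ≤ ∑ a ∈ t, g a :=
        Finset.sum_le_sum_of_subset_of_nonneg
          (fun a ha => (Finset.mem_filter.mp ha).2) fun a ha _ => hg a ha

theorem sum_zero_one_eq_card_filter {α β : Type*} (s : Finset α) (t : Finset β)
    (D : α → β → ℤ) (hD : ∀ u ∈ s, ∀ v ∈ t, D u v = 0 ∨ D u v = 1) :
    ∑ u ∈ s, ∑ v ∈ t, D u v = ((s ×ˢ t).filter (fun q => D q.1 q.2 = 1)).card := by
  rw [Finset.card_filter, ← Finset.sum_product']
  push_cast
  refine Finset.sum_congr rfl fun q hq => ?_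
  rw [Finset.mem_product] at hq
  rcases hD q.1 hq.1 q.2 hq.2 with h | h <;> simp [h]

/-- A contiguous part of a row made of a zero-one block of length `n`, the barrier `-(n+1)` and a
second zero-one block sums to at most the first block if it stops before the barrier, and to at
most the second block otherwise. -/
theorem sum_Icc_le_of_barrier {n : ℕ} {c a b : ℕ → ℤ}
    (ha : ∀ v ∈ Finset.Icc 1 n, a v = 0 ∨ a v = 1)
    (hb : ∀ v ∈ Finset.Icc 1 n, b v = 0 ∨ b v = 1)
    (h1 : ∀ v ∈ Finset.Icc 1 n, c v = a v) (h2 : c (n + 1) = -(n + 1))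
    (h3 : ∀ v ∈ Finset.Icc 1 n, c (n + 1 + v) = b v)
    {k l : ℕ} (hk : 1 ≤ k) (hl : l ≤ 2 * n + 1) :
    ∑ v ∈ Finset.Icc k l, c v ≤
      if l ≤ n then ∑ v ∈ Finset.Icc 1 n, a v else ∑ v ∈ Finset.Icc 1 n, b v := by
  have ha' : ∀ v ∈ Finset.Icc 1 n, 0 ≤ c v ∧ c v ≤ 1 := fun v hv => by
    have := ha v hv; have := h1 v hv; omega
  have hb' : ∀ v ∈ Finset.Icc (n + 2) (2 * n + 1), 0 ≤ c v := fun v hv => by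
    rw [Finset.mem_Icc] at hv
    have hv' : v - (n + 1) ∈ Finset.Icc 1 n := by rw [Finset.mem_Icc]; omega
    have e := h3 _ hv'
    rw [show n + 1 + (v - (n + 1)) = v by omega] at e
    have := hb _ hv'; omega
  have hsum : ∑ v ∈ Finset.Icc (n + 2) (2 * n + 1), c v = ∑ v ∈ Finset.Icc 1 n, b v := by
    rw [← Finset.sum_congr rfl h3, show Finset.Icc (n + 2) (2 * n + 1) =
      (Finset.Icc 1 n).map (addLeftEmbedding (n + 1)) by
        rw [Finset.map_add_left_Icc]; congr 1; omega, Finset.sum_map]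
    rfl
  split_ifs with h
  · rw [← Finset.sum_congr rfl h1]
    refine Finset.sum_le_sum_of_subset_of_nonneg ?_ fun v hv _ => (ha' v hv).1
    exact Finset.Icc_subset_Icc hk h
  · rw [← hsum]
    by_cases hk' : k ≤ n + 1
    · have hm : n + 1 ∈ Finset.Icc k l := by rw [Finset.mem_Icc]; omega
      rw [← Finset.add_sum_erase _ _ hm, h2]
      have hdisj : Disjoint (Finset.Icc 1 n) (Finset.Icc (n + 2) (2 * n + 1)) := by
        rw [Finset.disjoint_left]; intro v; simp only [Finset.mem_Icc]; omega
      have hle : ∑ v ∈ (Finset.Icc k l).erase (n + 1), c v ≤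
          ∑ v ∈ Finset.Icc 1 n ∪ Finset.Icc (n + 2) (2 * n + 1), c v := by
        refine Finset.sum_le_sum_of_subset_of_nonneg ?_ fun v hv _ => ?_
        · intro v; simp only [Finset.mem_erase, Finset.mem_union, Finset.mem_Icc]; omega
        · rcases Finset.mem_union.mp hv with hv | hv
          · exact (ha' v hv).1
          · exact hb' v hv
      rw [Finset.sum_union hdisj] at hle
      have hn : ∑ v ∈ Finset.Icc 1 n, c v ≤ ∑ v ∈ Finset.Icc 1 n, (1 : ℤ) :=
        Finset.sum_le_sum fun v hv => (ha' v hv).2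
      simp at hn
      linarith
    · refine Finset.sum_le_sum_of_subset_of_nonneg ?_ fun v hv _ => hb' v hv
      exact Finset.Icc_subset_Icc (by omega) hl


/-- The reduction from Majority to Maximum Submatrix: with
`C` built from the boolean matrix `x`, a `−(n+1)` barrier column, a boolean
matrix `D` with exactly `⌊n²/2⌋` ones, and `−1` elsewhere, the maximum
submatrix sum of `C` equals `max(∑ x, ⌊n²/2⌋)`; in particular it exceeds
`⌊n²/2⌋` iff `∑ x > ⌊n²/2⌋`. -/
theorem stmt13 (n : ℕ) (hn : 1 ≤ n) (x D : ℕ → ℕ → ℤ)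
    (hx : ∀ u ∈ Finset.Icc 1 n, ∀ v ∈ Finset.Icc 1 n, x u v = 0 ∨ x u v = 1)
    (hD : ∀ u ∈ Finset.Icc 1 n, ∀ v ∈ Finset.Icc 1 n, D u v = 0 ∨ D u v = 1)
    (hDcard : ((Finset.Icc 1 n ×ˢ Finset.Icc 1 n).filter
        (fun q => D q.1 q.2 = 1)).card = n ^ 2 / 2)
    (C : ℕ → ℕ → ℤ)
    (hC1 : ∀ u ∈ Finset.Icc 1 n, ∀ v ∈ Finset.Icc 1 n, C u v = x u v)
    (hC2 : ∀ u ∈ Finset.Icc 1 n, C u (n + 1) = -(n + 1))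
    (hC3 : ∀ u ∈ Finset.Icc 1 n, ∀ v ∈ Finset.Icc 1 n, C u (n + 1 + v) = D u v)
    (hC4 : ∀ u ∈ Finset.Icc (n + 1) (2 * n + 1), ∀ v ∈ Finset.Icc 1 (2 * n + 1),
      C u v = -1) :
    sSup {z : ℤ | ∃ i j k l : ℕ,
        1 ≤ i ∧ i ≤ j ∧ j ≤ 2 * n + 1 ∧ 1 ≤ k ∧ k ≤ l ∧ l ≤ 2 * n + 1 ∧
        z = ∑ u ∈ Finset.Icc i j, ∑ v ∈ Finset.Icc k l, C u v} =
      max (∑ u ∈ Finset.Icc 1 n, ∑ v ∈ Finset.Icc 1 n, x u v)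
        ((n ^ 2 / 2 : ℕ) : ℤ) ∧
    (sSup {z : ℤ | ∃ i j k l : ℕ,
        1 ≤ i ∧ i ≤ j ∧ j ≤ 2 * n + 1 ∧ 1 ≤ k ∧ k ≤ l ∧ l ≤ 2 * n + 1 ∧
        z = ∑ u ∈ Finset.Icc i j, ∑ v ∈ Finset.Icc k l, C u v} >
          ((n ^ 2 / 2 : ℕ) : ℤ) ↔
      ∑ u ∈ Finset.Icc 1 n, ∑ v ∈ Finset.Icc 1 n, x u v > ((n ^ 2 / 2 : ℕ) : ℤ)) := by
  have hDsum := sum_zero_one_eq_card_filter _ _ D hD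
  rw [hDcard] at hDsum
  suffices H : IsGreatest {z : ℤ | ∃ i j k l : ℕ,
        1 ≤ i ∧ i ≤ j ∧ j ≤ 2 * n + 1 ∧ 1 ≤ k ∧ k ≤ l ∧ l ≤ 2 * n + 1 ∧
        z = ∑ u ∈ Finset.Icc i j, ∑ v ∈ Finset.Icc k l, C u v}
      (max (∑ u ∈ Finset.Icc 1 n, ∑ v ∈ Finset.Icc 1 n, x u v) ((n ^ 2 / 2 : ℕ) : ℤ)) by
    rw [H.csSup_eq]
    refine ⟨rfl, ?_⟩
    rw [gt_iff_lt, lt_max_iff]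
    simp
  constructor
  · rcases max_choice (∑ u ∈ Finset.Icc 1 n, ∑ v ∈ Finset.Icc 1 n, x u v)
      ((n ^ 2 / 2 : ℕ) : ℤ) with h | h <;> rw [h]
    · refine ⟨1, n, 1, n, le_rfl, hn, by omega, le_rfl, hn, by omega, ?_⟩
      exact Finset.sum_congr rfl fun u hu => Finset.sum_congr rfl fun v hv => (hC1 u hu v hv).symm
    · refine ⟨1, n, n + 1 + 1, n + 1 + n, le_rfl, hn, by omega, by omega, by omega, by omega, ?_⟩
      rw [← hDsum, ← Finset.map_add_left_Icc]
      refine Finset.sum_congr rfl fun u hu => ?_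
      rw [Finset.sum_map]
      exact Finset.sum_congr rfl fun v hv => (hC3 u hu v hv).symm
  · rintro z ⟨i, j, k, l, hi, hij, hj, hk, hkl, hl, rfl⟩
    have key : ∑ u ∈ Finset.Icc i j, ∑ v ∈ Finset.Icc k l, C u v ≤
        ∑ u ∈ Finset.Icc 1 n, if l ≤ n then ∑ v ∈ Finset.Icc 1 n, x u v
          else ∑ v ∈ Finset.Icc 1 n, D u v := by
      refine Finset.sum_le_sum_of_nonpos_of_nonneg (fun u _ hu => ?_) (fun u hu hu' => ?_)
        fun u hu => ?_
      · exact sum_Icc_le_of_barrier (hx u hu) (hD u hu) (hC1 u hu) (hC2 u hu) (hC3 u hu) hk hl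
      · refine Finset.sum_nonpos fun v hv => ?_
        rw [Finset.mem_Icc] at hu hu' hv
        rw [hC4 u (by rw [Finset.mem_Icc]; omega) v (by rw [Finset.mem_Icc]; omega)]
        norm_num
      · split_ifs
        · exact Finset.sum_nonneg fun v hv => by have := hx u hu v hv; omega
        · exact Finset.sum_nonneg fun v hv => by have := hD u hu v hv; omega
    refine key.trans ?_
    split_ifs
    · exact le_max_left _ _
    · rw [hDsum]
      exact le_max_right _ _
end
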